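/- arXiv:1203.5460 — 3 statements merged into one kernel-verified Lean document; each statement's English description precedes it below -/
import Mathlib

section
/- There is an absolute constant C > 0 such that for every L ≥ 1, every μ ≥ (2π/L)², and all ψ₁, ψ₂ ∈ ℂ, if q₁ = −μψ₁ − (ψ₁ − ψ₂)/2 and q₂ = −μψ₂ + (ψ₁ − ψ₂)/2, then (1/C) μ² (|ψ₁|² + |ψ₂|²) ≤ |q₁|² + |q₂|² ≤ C (1 + L⁴) μ² (|ψ₁|² + |ψ₂|²). -/
/-- The energy identity for the two-layer elliptic system at a Fourier mode. -/
lemma norm_sq_add_norm_sq_two_layer (μ : ℝ) (ψ₁ ψ₂ : ℂ) :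
    ‖-(μ : ℂ) * ψ₁ - (ψ₁ - ψ₂) / 2‖ ^ 2 + ‖-(μ : ℂ) * ψ₂ + (ψ₁ - ψ₂) / 2‖ ^ 2 =
      μ ^ 2 * (‖ψ₁‖ ^ 2 + ‖ψ₂‖ ^ 2) + (μ + 1 / 2) * ‖ψ₁ - ψ₂‖ ^ 2 := by
  simp only [Complex.sq_norm, Complex.normSq_apply]
  simp
  ring

/-- Per-Fourier-mode elliptic norm equivalence for the two-layer
quasi-geostrophic model: there is an absolute constant `C > 0` such that for
every `L ≥ 1`, every `μ ≥ (2π/L)²`, and all `ψ₁, ψ₂ ∈ ℂ`, if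
`q₁ = -μψ₁ - (ψ₁ - ψ₂)/2` and `q₂ = -μψ₂ + (ψ₁ - ψ₂)/2`, then
`(1/C) μ² (|ψ₁|² + |ψ₂|²) ≤ |q₁|² + |q₂|² ≤ C (1 + L⁴) μ² (|ψ₁|² + |ψ₂|²)`. -/
theorem stmt_4 :
    ∃ C : ℝ, 0 < C ∧
      ∀ L : ℝ, 1 ≤ L → ∀ μ : ℝ, (2 * Real.pi / L)^2 ≤ μ →
        ∀ ψ₁ ψ₂ q₁ q₂ : ℂ,
          q₁ = -(μ : ℂ) * ψ₁ - (ψ₁ - ψ₂) / 2 →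
          q₂ = -(μ : ℂ) * ψ₂ + (ψ₁ - ψ₂) / 2 →
          (1 / C) * μ^2 * (‖ψ₁‖^2 + ‖ψ₂‖^2) ≤ ‖q₁‖^2 + ‖q₂‖^2 ∧
          ‖q₁‖^2 + ‖q₂‖^2 ≤ C * (1 + L^4) * μ^2 * (‖ψ₁‖^2 + ‖ψ₂‖^2) := by
  refine ⟨2, by norm_num, ?_⟩
  rintro L hL μ hμ ψ₁ ψ₂ q₁ q₂ rfl rfl
  have hL0 : 0 < L := by linarith
  have hμ0 : 0 ≤ μ := (sq_nonneg _).trans hμ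
  have hμL : 1 ≤ L ^ 2 * μ := by
    rw [div_pow, div_le_iff₀ (by positivity)] at hμ
    nlinarith [Real.pi_gt_three]
  have hL4 : 1 ≤ L ^ 4 * μ ^ 2 := by
    calc (1 : ℝ) ≤ (L ^ 2 * μ) ^ 2 := one_le_pow₀ hμL
      _ = L ^ 4 * μ ^ 2 := by ring
  have hd : ‖ψ₁ - ψ₂‖ ^ 2 ≤ 2 * (‖ψ₁‖ ^ 2 + ‖ψ₂‖ ^ 2) := by
    have h := parallelogram_law_with_norm ℝ ψ₁ ψ₂
    nlinarith [sq_nonneg ‖ψ₁ + ψ₂‖]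
  rw [norm_sq_add_norm_sq_two_layer]
  have hS : 0 ≤ ‖ψ₁‖ ^ 2 + ‖ψ₂‖ ^ 2 := by positivity
  have hD : 0 ≤ ‖ψ₁ - ψ₂‖ ^ 2 := by positivity
  generalize ‖ψ₁‖ ^ 2 + ‖ψ₂‖ ^ 2 = S at *
  generalize ‖ψ₁ - ψ₂‖ ^ 2 = D at *
  constructor
  · have h₁ : 0 ≤ μ ^ 2 * S := by positivity
    have h₂ : 0 ≤ (μ + 1 / 2) * D := by positivity
    linarith
  · calc μ ^ 2 * S + (μ + 1 / 2) * D ≤ μ ^ 2 * S + (μ + 1 / 2) * (2 * S) := by gcongr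
      _ = (μ + 1) ^ 2 * S := by ring
      _ ≤ 2 * (1 + L ^ 4) * μ ^ 2 * S := by
        gcongr
        nlinarith [sq_nonneg (μ - 1)]
end

section
/- Let L > 0, β ∈ ℝ, and k = (k₁,k₂) ∈ ℤ² \ {(0,0)}; set s = 2π k₁ / L and μ = (2π|k|/L)². Let M be the complex 2×2 matrix with entries a = −i s (1 − (β + 1/2) α), b = i s (β + 1/2) γ, c = i s (β − 1/2) γ, d = i s (β − 1/2) α, where α = (μ + 1/2)/(μ² + μ) and γ = (1/2)/(μ² + μ). Then tr M = −i s (1 − 2βα), which is purely imaginary, and (tr M)² − 4 det M is the real number s² γ² ((1 − 4β²) − (2μ² − 1)²). -/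
open Matrix

/-- Trace and discriminant of the Fourier-mode matrix of the linearized
two-layer quasi-geostrophic system in the inviscid, undamped case: with
`s = 2πk₁/L`, `μ = (2π|k|/L)²`, `α = (μ + 1/2)/(μ² + μ)`,
`γ = (1/2)/(μ² + μ)`, the matrix `M = !![a, b; c, d]` with
`a = -i s (1 - (β + 1/2)α)`, `b = i s (β + 1/2)γ`, `c = i s (β - 1/2)γ`,
`d = i s (β - 1/2)α` satisfies `tr M = -i s (1 - 2βα)` (purely imaginary) and
`(tr M)² - 4 det M = s² γ² ((1 - 4β²) - (2μ² - 1)²)`, a real number. -/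
theorem stmt_5 (L : ℝ) (hL : 0 < L) (β : ℝ) (k : ℤ × ℤ) (hk : k ≠ 0)
    (s μ α γ : ℝ)
    (hs : s = 2 * Real.pi * (k.1 : ℝ) / L)
    (hμ : μ = (2 * Real.pi * Real.sqrt ((k.1 : ℝ)^2 + (k.2 : ℝ)^2) / L)^2)
    (hα : α = (μ + 1/2) / (μ^2 + μ)) (hγ : γ = (1/2) / (μ^2 + μ))
    (M : Matrix (Fin 2) (Fin 2) ℂ)
    (hM : M = !![-Complex.I * s * (1 - (β + 1/2) * α),
                  Complex.I * s * ((β + 1/2) * γ);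
                  Complex.I * s * ((β - 1/2) * γ),
                  Complex.I * s * ((β - 1/2) * α)]) :
    M.trace = -Complex.I * s * (1 - 2 * β * α) ∧ (M.trace).re = 0 ∧
    (M.trace)^2 - 4 * M.det =
      ((s^2 * γ^2 * ((1 - 4 * β^2) - (2 * μ^2 - 1)^2) : ℝ) : ℂ) := by
  have hμ_pos : 0 < μ := by
    have hnorm : 0 < (k.1 : ℝ) ^ 2 + (k.2 : ℝ) ^ 2 := by
      have hk' : k.1 ≠ 0 ∨ k.2 ≠ 0 := by
        by_contra! h
        exact hk (Prod.ext h.1 h.2)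
      rcases hk' with h | h <;> positivity
    rw [hμ]
    have := Real.sqrt_pos.mpr hnorm
    positivity
  have hα_eq : α = 1 - γ * (2 * μ ^ 2 - 1) := by
    have : μ ^ 2 + μ ≠ 0 := by positivity
    rw [hα, hγ]
    field_simp
    ring
  have htrace : M.trace = -Complex.I * s * (1 - 2 * β * α) := by
    rw [hM, Matrix.trace_fin_two_of]
    ring
  refine ⟨htrace, ?_, ?_⟩
  · rw [htrace]
    simp
  · rw [htrace, hM, Matrix.det_fin_two_of, hα_eq]
    push_cast
    ring_nf
    simp only [Complex.I_sq]
    ring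
end

section
/- Let L > 0, β ∈ ℝ with 4β² < 1, and k = (k₁,k₂) ∈ ℤ² \ {(0,0)} with k₁ ≠ 0; set μ = (2π|k|/L)². If (2μ² − 1)² < 1 − 4β², then the matrix M (the Fourier-mode matrix of the linearized two-layer quasi-geostrophic system at κ_T = κ_M = ν = 0) has an eigenvalue with strictly positive real part. In particular, the linearized two-layer quasi-geostrophic system about the zero state is linearly unstable for such parameters. -/
open Matrix

/-- A complex number whose offset from half the trace squares to a quarter of the discriminant
is a root of the characteristic polynomial of a `2 × 2` matrix. -/
theorem charpoly_fin_two_isRoot_of_sq_eq {a b c d r : ℂ}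
    (hr : 4 * r ^ 2 = (a - d) ^ 2 + 4 * (b * c)) :
    (!![a, b; c, d] : Matrix (Fin 2) (Fin 2) ℂ).charpoly.IsRoot ((a + d) / 2 + r) := by
  rw [Matrix.charpoly_fin_two, Polynomial.IsRoot.def]
  simp only [Matrix.trace_fin_two_of, Matrix.det_fin_two_of, Polynomial.eval_add,
    Polynomial.eval_sub, Polynomial.eval_pow, Polynomial.eval_mul, Polynomial.eval_X,
    Polynomial.eval_C]
  linear_combination hr / 4

/-- The discriminant of the two-layer mode matrix, divided by `(i s)²`, is negative. -/
theorem twoLayer_discriminant_neg {μ β : ℝ} (hμ : 0 < μ)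
    (hdisc : (2 * μ ^ 2 - 1) ^ 2 < 1 - 4 * β ^ 2) :
    ((μ + 1 / 2) / (μ ^ 2 + μ) - 1) ^ 2
      + (4 * β ^ 2 - 1) * ((1 / 2) / (μ ^ 2 + μ)) ^ 2 < 0 := by
  have hD : 0 < μ ^ 2 + μ := by positivity
  have h : ((μ + 1 / 2) / (μ ^ 2 + μ) - 1) ^ 2
      + (4 * β ^ 2 - 1) * ((1 / 2) / (μ ^ 2 + μ)) ^ 2
      = ((2 * μ ^ 2 - 1) ^ 2 - (1 - 4 * β ^ 2)) / (4 * (μ ^ 2 + μ) ^ 2) := by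
    field_simp
    ring
  rw [h]
  exact div_neg_of_neg_of_pos (by linarith) (by positivity)

/-- Linear instability of the two-layer quasi-geostrophic model (core of
Proposition 2.1): for `L > 0`, `β` with `4β² < 1`, and a Fourier mode
`k = (k₁,k₂) ∈ ℤ² \ {0}` with `k₁ ≠ 0` and `μ = (2π|k|/L)²` satisfying
`(2μ² - 1)² < 1 - 4β²`, the Fourier-mode matrix `M` of the linearization at
`κ_T = κ_M = ν = 0` has an eigenvalue with strictly positive real part. -/
theorem stmt_8 (L : ℝ) (hL : 0 < L) (β : ℝ) (hβ : 4 * β^2 < 1)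
    (k : ℤ × ℤ) (hk : k ≠ 0) (hk₁ : k.1 ≠ 0)
    (s μ α γ : ℝ)
    (hs : s = 2 * Real.pi * (k.1 : ℝ) / L)
    (hμ : μ = (2 * Real.pi * Real.sqrt ((k.1 : ℝ)^2 + (k.2 : ℝ)^2) / L)^2)
    (hα : α = (μ + 1/2) / (μ^2 + μ)) (hγ : γ = (1/2) / (μ^2 + μ))
    (hdisc : (2 * μ^2 - 1)^2 < 1 - 4 * β^2)
    (M : Matrix (Fin 2) (Fin 2) ℂ)
    (hM : M = !![-Complex.I * s * (1 - (β + 1/2) * α),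
                  Complex.I * s * ((β + 1/2) * γ);
                  Complex.I * s * ((β - 1/2) * γ),
                  Complex.I * s * ((β - 1/2) * α)]) :
    ∃ lam : ℂ, (Matrix.charpoly M).IsRoot lam ∧ 0 < lam.re := by
  have hk₁' : (k.1 : ℝ) ≠ 0 := Int.cast_ne_zero.mpr hk₁
  have hs0 : s ≠ 0 := by
    rw [hs]
    have := Real.pi_ne_zero
    have := hL.ne'
    positivity
  have hμ0 : 0 < μ := by
    rw [hμ]
    have : 0 < (k.1 : ℝ) ^ 2 + (k.2 : ℝ) ^ 2 := by positivity
    positivity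
  have hneg : (α - 1) ^ 2 + (4 * β ^ 2 - 1) * γ ^ 2 < 0 := by
    rw [hα, hγ]
    exact twoLayer_discriminant_neg hμ0 hdisc
  have hδ : 0 < s ^ 2 * -((α - 1) ^ 2 + (4 * β ^ 2 - 1) * γ ^ 2) :=
    mul_pos (by positivity) (neg_pos.mpr hneg)
  obtain ⟨r, hr0, hr⟩ : ∃ r : ℝ, 0 < r ∧
      4 * r ^ 2 = s ^ 2 * -((α - 1) ^ 2 + (4 * β ^ 2 - 1) * γ ^ 2) := by
    refine ⟨Real.sqrt (s ^ 2 * -((α - 1) ^ 2 + (4 * β ^ 2 - 1) * γ ^ 2)) / 2,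
      half_pos (Real.sqrt_pos.mpr hδ), ?_⟩
    rw [div_pow, Real.sq_sqrt hδ.le]
    ring
  have hrC : 4 * (r : ℂ) ^ 2 = s ^ 2 * -((α - 1) ^ 2 + (4 * β ^ 2 - 1) * γ ^ 2) := by
    exact_mod_cast hr
  subst hM
  refine ⟨_, charpoly_fin_two_isRoot_of_sq_eq (r := r) ?_, ?_⟩
  · linear_combination hrC
      - s ^ 2 * ((α - 1) ^ 2 + (4 * β ^ 2 - 1) * γ ^ 2) * Complex.I_sq
  · have htrace : (-Complex.I * s * (1 - (β + 1 / 2) * α)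
        + Complex.I * s * ((β - 1 / 2) * α)) / 2 + r
        = (r : ℂ) + ((s * (2 * β * α - 1) / 2 : ℝ) : ℂ) * Complex.I := by
      push_cast
      ring
    rw [htrace, Complex.add_re, Complex.re_ofReal_mul, Complex.I_re, mul_zero, add_zero]
    exact hr0
end
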